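/- Let n ∈ ℕ, let ψ(q) = q^{-τ_ψ} and φ(q) = q^{-τ_φ} where τ_ψ, τ_φ ∈ ℝ_{>0} and τ_ψ ≥ 1/n. Then the Hausdorff dimension of W_n(ψ,φ) equals min{ (n+1)/(1+τ_ψ) , (n+1+(n-1)τ_φ)/(1+τ_ψ+τ_φ) }. -/

import Mathlib

open MeasureTheory Filter Set

/-- The unit cube `[0,1]^n` in `ℝ^n` (with the maximum norm). -/
def unitCube (n : ℕ) : Set (Fin n → ℝ) := Set.univ.pi fun _ => Set.Icc (0 : ℝ) 1

/-- `W_n(ψ, φ)`: the set of `x ∈ [0,1]^n` such that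
`(1-φ(q))·ψ(q)/q < ‖x - p/q‖ < ψ(q)/q` for infinitely many pairs `(p,q) ∈ ℤ^n × ℕ`. -/
def Wpsiphi (n : ℕ) (ψ φ : ℕ → ℝ) : Set (Fin n → ℝ) :=
  {x ∈ unitCube n |
    {pq : (Fin n → ℤ) × ℕ | 0 < pq.2 ∧
      (1 - φ pq.2) * (ψ pq.2 / pq.2) < ‖x - fun i => (pq.1 i : ℝ) / pq.2‖ ∧
      ‖x - fun i => (pq.1 i : ℝ) / pq.2‖ < ψ pq.2 / pq.2}.Infinite}

open scoped ENNReal NNReal Topology MeasureTheory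

/-- Hausdorff–Cantelli: a limsup set of finite families of sets whose diameters have summable
`s`-th powers is null for the `s`-dimensional Hausdorff measure. -/
lemma hausdorffMeasure_eq_zero_of_limsup_cover {X β : Type*} [EMetricSpace X] [MeasurableSpace X]
    [BorelSpace X] {E : Set X} (I : ℕ → Finset β) (A : ℕ → β → Set X) (d : ℕ → ℝ≥0∞) {s : ℝ}
    (hs : 0 ≤ s) (hd : Tendsto d atTop (𝓝 0)) (hanti : Antitone d)
    (hA : ∀ q, ∀ i ∈ I q, Metric.ediam (A q i) ≤ d q)
    (hsum : ∑' q, ((I q).card : ℝ≥0∞) * d q ^ s ≠ ∞)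
    (hE : ∀ x ∈ E, ∀ N, ∃ q ≥ N, ∃ i ∈ I q, x ∈ A q i) : μH[s] E = 0 := by
  have key := Measure.hausdorffMeasure_le_liminf_tsum
    (ι := fun N : ℕ => Σ k : ℕ, {i // i ∈ I (k + N)}) s E (l := atTop) d hd
    (fun N i => A (i.1 + N) i.2)
    (.of_forall fun N i => (hA _ _ i.2.2).trans (hanti (Nat.le_add_left _ _)))
    (.of_forall fun N x hx => by
      obtain ⟨q, hq, i, hi, hxi⟩ := hE x hx N
      obtain ⟨k, rfl⟩ := Nat.exists_eq_add_of_le' hq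
      exact mem_iUnion.2 ⟨⟨k, i, hi⟩, hxi⟩)
  have hle : ∀ N, (∑' i : (Σ k : ℕ, {i // i ∈ I (k + N)}), Metric.ediam (A (i.1 + N) i.2) ^ s) ≤
      ∑' k, ((I (k + N)).card : ℝ≥0∞) * d (k + N) ^ s := by
    intro N
    rw [ENNReal.tsum_sigma']
    refine ENNReal.tsum_le_tsum fun k => ?_
    rw [tsum_fintype]
    calc _ ≤ ∑ _b : {i // i ∈ I (k + N)}, d (k + N) ^ s :=
          Finset.sum_le_sum fun b _ => ENNReal.rpow_le_rpow (hA _ _ b.2) hs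
      _ = _ := by simp
  have hlim := ENNReal.tendsto_sum_nat_add (fun q => ((I q).card : ℝ≥0∞) * d q ^ s) hsum
  refine le_antisymm (key.trans ?_) zero_le
  rw [← hlim.liminf_eq]
  exact liminf_le_liminf (.of_forall hle)

lemma num_mem_Icc_of_abs_sub_lt_one {x : ℝ} (hx : x ∈ Icc (0 : ℝ) 1) {p : ℤ} {q : ℕ} (hq : 0 < q)
    (h : |x - p / q| < 1) : p ∈ Finset.Icc (-q : ℤ) (2 * q) := by
  have hq' : (0 : ℝ) < q := by exact_mod_cast hq
  rw [abs_lt] at h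
  have h1 : (p : ℝ) / q < 2 := by linarith [hx.2]
  have h2 : -1 < (p : ℝ) / q := by linarith [hx.1]
  rw [div_lt_iff₀ hq'] at h1
  rw [lt_div_iff₀ hq'] at h2
  rw [Finset.mem_Icc]
  constructor
  · have : (-q : ℝ) ≤ p := by linarith
    exact_mod_cast this
  · exact_mod_cast h1.le

lemma exists_le_denominator {n : ℕ} {x : Fin n → ℝ} (hx : x ∈ unitCube n)
    {S : Set ((Fin n → ℤ) × ℕ)} (hS : S.Infinite)
    (h : ∀ pq ∈ S, 0 < pq.2 ∧ ‖x - fun i => (pq.1 i : ℝ) / pq.2‖ < 1) (N : ℕ) :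
    ∃ pq ∈ S, N ≤ pq.2 ∧ pq.1 ∈ Fintype.piFinset fun _ => Finset.Icc (-pq.2 : ℤ) (2 * pq.2) := by
  have hp : ∀ pq ∈ S, pq.1 ∈ Fintype.piFinset fun _ => Finset.Icc (-pq.2 : ℤ) (2 * pq.2) := by
    intro pq hpq
    rw [Fintype.mem_piFinset]
    intro i
    refine num_mem_Icc_of_abs_sub_lt_one (hx i (mem_univ i)) (h pq hpq).1
      (lt_of_le_of_lt ?_ (h pq hpq).2)
    simpa using norm_le_pi_norm (x - fun i => (pq.1 i : ℝ) / pq.2) i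
  by_contra! hcon
  refine hS (((Fintype.piFinset fun _ : Fin n => Finset.Icc (-N : ℤ) (2 * N)) ×ˢ
    Finset.range N).finite_toSet.subset fun pq hpq => ?_)
  have hlt : pq.2 < N := by
    by_contra! hle
    exact hcon pq hpq hle (hp pq hpq)
  have := hp pq hpq
  simp only [Fintype.mem_piFinset, Finset.mem_Icc] at this
  simp only [Finset.coe_product, Set.mem_prod, Finset.mem_coe, Fintype.mem_piFinset,
    Finset.mem_Icc, Finset.mem_range]
  exact ⟨fun i => ⟨by linarith [(this i).1], by linarith [(this i).2]⟩, hlt⟩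

/-- The part of the slab of thickness `w` under the face of direction `(j, b)` of the cube of radius
`R` around `y` whose other coordinates lie in the cell `v` of the grid of mesh `w`. -/
def faceCell {n : ℕ} (y : Fin n → ℝ) (R w : ℝ) (j : Fin n) (b : Bool) (v : Fin n → ℤ) :
    Set (Fin n → ℝ) :=
  {x | (if b then x j - y j else y j - x j) ∈ Icc (R - w) R ∧
    ∀ k ≠ j, x k - y k ∈ Icc (v k * w) (v k * w + w)}

lemma ediam_faceCell_le {n : ℕ} (y : Fin n → ℝ) (R : ℝ) {w : ℝ} (hw : 0 ≤ w) (j : Fin n) (b : Bool)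
    (v : Fin n → ℤ) : Metric.ediam (faceCell y R w j b v) ≤ ENNReal.ofReal w := by
  refine Metric.ediam_le fun x hx z hz => ?_
  rw [edist_dist]
  refine ENNReal.ofReal_le_ofReal ((dist_pi_le_iff hw).2 fun k => ?_)
  rw [Real.dist_eq, abs_le]
  obtain ⟨hx1, hx2⟩ := hx
  obtain ⟨hz1, hz2⟩ := hz
  rcases eq_or_ne k j with rfl | hk
  · cases b <;> simp only [Bool.false_eq_true, if_true, if_false, mem_Icc] at hx1 hz1 <;>
      constructor <;> linarith [hx1.1, hx1.2, hz1.1, hz1.2]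
  · have h1 := hx2 k hk
    have h2 := hz2 k hk
    rw [mem_Icc] at h1 h2
    constructor <;> linarith [h1.1, h1.2, h2.1, h2.2]

/-- Grid cells on the face orthogonal to the `j`-th axis. -/
noncomputable def faceGrid {n : ℕ} (m : ℕ) (j : Fin n) : Finset (Fin n → ℤ) :=
  Fintype.piFinset fun k => if k = j then {0} else Finset.Icc (-m : ℤ) m

lemma card_faceGrid {n : ℕ} (m : ℕ) (j : Fin n) : (faceGrid m j).card = (2 * m + 1) ^ (n - 1) := by
  rw [faceGrid, Fintype.card_piFinset,
    ← Finset.mul_prod_erase Finset.univ _ (Finset.mem_univ j)]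
  simp only [if_true, Finset.card_singleton, one_mul]
  rw [Finset.prod_congr rfl (g := fun _ => 2 * m + 1)]
  · simp
  · intro k hk
    rw [if_neg (Finset.ne_of_mem_erase hk), Int.card_Icc]
    omega

/-- The annulus of outer radius `R` and width `w` is covered by the cells of its faces. -/
lemma exists_mem_faceCell {n : ℕ} (hn : 0 < n) {x y : Fin n → ℝ} {R w : ℝ} (hw : 0 < w)
    {m : ℕ} (hm : R / w ≤ m) (h1 : R - w < ‖x - y‖) (h2 : ‖x - y‖ < R) :
    ∃ j b, ∃ v ∈ faceGrid m j, x ∈ faceCell y R w j b v := by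
  have hR : 0 < R := (norm_nonneg _).trans_lt h2
  have : Nonempty (Fin n) := ⟨⟨0, hn⟩⟩
  have hex : ∃ j, R - w < |x j - y j| := by
    by_contra! hcon
    exact absurd ((pi_norm_le_iff_of_nonempty (x - y)).2 hcon) h1.not_ge
  have hlt : ∀ k, |x k - y k| < R := (pi_norm_lt_iff hR).1 h2
  obtain ⟨j, hj⟩ := hex
  refine ⟨j, decide (y j ≤ x j), fun k => if k = j then 0 else ⌊(x k - y k) / w⌋, ?_, ?_, ?_⟩
  · rw [faceGrid, Fintype.mem_piFinset]
    intro k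
    by_cases hk : k = j
    · simp [hk]
    · have hk' := abs_lt.1 (hlt k)
      have ha : (x k - y k) / w < m := (div_lt_div_of_pos_right hk'.2 hw).trans_le hm
      have hb : (-m : ℝ) < (x k - y k) / w := by
        have := (div_lt_div_of_pos_right hk'.1 hw)
        rw [neg_div] at this
        linarith
      simp only [hk, if_false, Finset.mem_Icc]
      constructor
      · rw [Int.le_floor]; push_cast; exact hb.le
      · have := (Int.floor_le ((x k - y k) / w)).trans_lt ha
        exact_mod_cast this.le
  · have hj2 := hlt j
    by_cases hxy : y j ≤ x j
    · rw [abs_of_nonneg (by linarith)] at hj hj2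
      simp only [hxy, decide_true, if_true]
      exact ⟨hj.le, hj2.le⟩
    · rw [abs_of_nonpos (by linarith)] at hj hj2
      simp only [hxy, decide_false, Bool.false_eq_true, if_false]
      exact ⟨by linarith, by linarith⟩
  · intro k hk
    simp only [hk, if_false]
    have ha := Int.floor_le ((x k - y k) / w)
    have hb := Int.lt_floor_add_one ((x k - y k) / w)
    rw [le_div_iff₀ hw] at ha
    rw [div_lt_iff₀ hw] at hb
    exact ⟨ha, by linarith⟩

lemma hausdorffMeasure_Wpsiphi_eq_zero {n : ℕ} (hn : 0 < n) {τ σ s : ℝ} (hτ : 0 < τ) (hσ : 0 ≤ σ)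
    (hs : ((n : ℝ) + 1 + ((n : ℝ) - 1) * σ) / (1 + τ + σ) < s) :
    μH[s] (Wpsiphi n (fun q => (q : ℝ) ^ (-τ)) (fun q => (q : ℝ) ^ (-σ))) = 0 := by
  have hn1 : (1 : ℝ) ≤ n := by exact_mod_cast hn
  have hs0 : 0 ≤ s := le_trans (by have := sub_nonneg.2 hn1; positivity) hs.le
  rw [div_lt_iff₀ (by positivity)] at hs
  let w : ℕ → ℝ := fun q => ((q + 1 : ℕ) : ℝ) ^ (-(1 + τ + σ))
  let m : ℕ → ℕ := fun q => ⌈((q + 1 : ℕ) : ℝ) ^ σ⌉₊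
  have hw : ∀ q, 0 < w q := fun q => Real.rpow_pos_of_pos (by positivity) _
  have hcard : ∀ q, ((m q : ℝ)) ≤ 2 * ((q + 1 : ℕ) : ℝ) ^ σ := fun q => by
    have h1 : (1 : ℝ) ≤ ((q + 1 : ℕ) : ℝ) ^ σ := Real.one_le_rpow (by simp) hσ
    have := Nat.ceil_lt_add_one (zero_le_one.trans h1)
    simp only [m]; linarith
  refine hausdorffMeasure_eq_zero_of_limsup_cover
    (I := fun q => (Finset.univ : Finset (Fin n × Bool)).sigma fun jb =>
      (Fintype.piFinset fun _ : Fin n =>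
        Finset.Icc (-(q + 1 : ℕ) : ℤ) (2 * (q + 1 : ℕ))) ×ˢ faceGrid (m q) jb.1)
    (A := fun q i => faceCell (fun k => (i.2.1 k : ℝ) / (q + 1 : ℕ)) (((q + 1 : ℕ) : ℝ) ^ (-(1 + τ)))
      (w q) i.1.1 i.1.2 i.2.2)
    (fun q => ENNReal.ofReal (w q)) hs0 ?_ ?_ ?_ ?_ ?_
  · rw [← ENNReal.ofReal_zero]
    refine ENNReal.tendsto_ofReal ?_
    exact ((tendsto_rpow_neg_atTop (by positivity)).comp tendsto_natCast_atTop_atTop).comp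
      (tendsto_add_atTop_nat 1)
  · intro a b hab
    refine ENNReal.ofReal_le_ofReal ?_
    refine Real.rpow_le_rpow_of_nonpos (by positivity) (by exact_mod_cast Nat.succ_le_succ hab) ?_
    linarith
  · intro q i _
    exact ediam_faceCell_le _ _ (hw q).le _ _ _
  · set C : ℝ := 2 * n * 4 ^ n * 5 ^ (n - 1) with hC
    have hsummable : Summable fun q : ℕ =>
        C * ((q + 1 : ℕ) : ℝ) ^ (n + σ * (n - 1) - (1 + τ + σ) * s) := by
      refine Summable.mul_left _ ?_
      exact (summable_nat_add_iff 1).2 (Real.summable_nat_rpow.2 (by nlinarith))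
    refine ne_top_of_le_ne_top hsummable.tsum_ofReal_ne_top (ENNReal.tsum_le_tsum fun q => ?_)
    have hq0 : (0 : ℝ) < ((q + 1 : ℕ) : ℝ) := by positivity
    rw [ENNReal.ofReal_rpow_of_nonneg (hw q).le hs0, ← ENNReal.ofReal_natCast,
      ← ENNReal.ofReal_mul (by positivity)]
    refine ENNReal.ofReal_le_ofReal ?_
    have hc : ((((Finset.univ : Finset (Fin n × Bool)).sigma fun jb =>
      (Fintype.piFinset fun _ : Fin n =>
        Finset.Icc (-(q + 1 : ℕ) : ℤ) (2 * (q + 1 : ℕ))) ×ˢ faceGrid (m q) jb.1).card : ℕ) : ℝ) ≤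
        C * (((q + 1 : ℕ) : ℝ) ^ (n : ℝ) * ((q + 1 : ℕ) : ℝ) ^ (σ * (n - 1))) := by
      have e1 : (2 * (m q : ℝ) + 1) ≤ 5 * ((q + 1 : ℕ) : ℝ) ^ σ := by
        have h1 : (1 : ℝ) ≤ ((q + 1 : ℕ) : ℝ) ^ σ := Real.one_le_rpow (by simp) hσ
        linarith [hcard q]
      have e2 : ((q + 1 : ℕ) : ℝ) ^ (σ * (n - 1)) = (((q + 1 : ℕ) : ℝ) ^ σ) ^ (n - 1) := by
        rw [Real.rpow_mul hq0.le, ← Real.rpow_natCast _ (n - 1), Nat.cast_sub hn, Nat.cast_one]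
      have e3 : (2 * ((q + 1 : ℕ) : ℤ) + 1 - -((q + 1 : ℕ) : ℤ)).toNat = 3 * (q + 1) + 1 := by
        omega
      have e4 : ((3 * (q + 1) + 1 : ℕ) : ℝ) ≤ 4 * ((q + 1 : ℕ) : ℝ) := by push_cast; linarith
      simp only [Finset.card_sigma, Finset.card_product, Fintype.card_piFinset, Int.card_Icc,
        card_faceGrid, Finset.prod_const, Finset.card_univ, Fintype.card_fin, Finset.sum_const,
        Fintype.card_prod, Fintype.card_bool, e3]
      rw [e2, Real.rpow_natCast, hC]
      calc _ = (n * 2 : ℝ) * (((3 * (q + 1) + 1 : ℕ) : ℝ) ^ n * (2 * (m q : ℝ) + 1) ^ (n - 1)) := by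
            simp only [smul_eq_mul]; push_cast; ring
        _ ≤ (n * 2 : ℝ) * ((4 * ((q + 1 : ℕ) : ℝ)) ^ n *
              (5 * ((q + 1 : ℕ) : ℝ) ^ σ) ^ (n - 1)) := by gcongr
        _ = _ := by rw [mul_pow, mul_pow]; ring
    calc _ ≤ C * (((q + 1 : ℕ) : ℝ) ^ (n : ℝ) * ((q + 1 : ℕ) : ℝ) ^ (σ * (n - 1))) * w q ^ s :=
          mul_le_mul_of_nonneg_right hc (Real.rpow_nonneg (hw q).le _)
      _ = _ := by
        simp only [w]
        rw [← Real.rpow_mul hq0.le, ← Real.rpow_add hq0, mul_assoc, ← Real.rpow_add hq0]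
        congr 2; ring
  · intro x hx N
    obtain ⟨⟨p, q⟩, ⟨hq0, ha, hb⟩, hNq, hp⟩ := exists_le_denominator hx.1 hx.2 (fun pq hpq =>
      ⟨hpq.1, hpq.2.2.trans_le <| by
        have : (1 : ℝ) ≤ pq.2 := by exact_mod_cast hpq.1
        exact div_le_one_of_le₀ ((Real.rpow_le_one_of_one_le_of_nonpos this (by linarith)).trans
          this) (by positivity)⟩) (N + 1)
    obtain ⟨q, rfl⟩ : ∃ k, q = k + 1 := ⟨q - 1, by simp only at hq0; omega⟩
    have hq' : (0 : ℝ) < ((q + 1 : ℕ) : ℝ) := by positivity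
    have eR : ((q + 1 : ℕ) : ℝ) ^ (-τ) / ((q + 1 : ℕ) : ℝ) = ((q + 1 : ℕ) : ℝ) ^ (-(1 + τ)) := by
      rw [← Real.rpow_sub_one hq'.ne']; congr 1; ring
    have ew : ((q + 1 : ℕ) : ℝ) ^ (-σ) * ((q + 1 : ℕ) : ℝ) ^ (-(1 + τ)) = w q := by
      simp only [w]
      rw [← Real.rpow_add hq']; congr 1; ring
    simp only at ha hb
    rw [eR] at ha hb
    rw [sub_mul, one_mul, ew] at ha
    obtain ⟨j, b, v, hv, hxv⟩ := exists_mem_faceCell hn (hw q) (m := m q) (by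
      refine le_trans (le_of_eq ?_) (Nat.le_ceil _)
      simp only [w]
      rw [← Real.rpow_sub hq']; congr 1; ring) ha hb
    refine ⟨q, by simp only at hNq; omega, ⟨(j, b), p, v⟩, ?_, hxv⟩
    simp only [Finset.mem_sigma, Finset.mem_univ, true_and, Finset.mem_product]
    exact ⟨hp, hv⟩

lemma Wpsiphi_subset_of_le {n : ℕ} {ψ φ φ' : ℕ → ℝ} (hψ : ∀ q, 0 ≤ ψ q)
    (h : ∀ q, 0 < q → φ q ≤ φ' q) : Wpsiphi n ψ φ ⊆ Wpsiphi n ψ φ' := by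
  refine fun x hx => ⟨hx.1, hx.2.mono fun pq hpq => ⟨hpq.1, lt_of_le_of_lt ?_ hpq.2.1, hpq.2.2⟩⟩
  have := div_nonneg (hψ pq.2) (Nat.cast_nonneg pq.2)
  exact mul_le_mul_of_nonneg_right (by linarith [h pq.2 hpq.1]) this

lemma dimH_le_ofReal_of_forall_gt {X : Type*} [EMetricSpace X] [MeasurableSpace X] [BorelSpace X]
    {E : Set X} {t : ℝ} (h : ∀ s, t < s → μH[s] E = 0) : dimH E ≤ ENNReal.ofReal t := by
  refine dimH_le fun d hd => ?_
  by_contra! hlt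
  have : t < d := by
    rw [← ENNReal.ofReal_coe_nnreal] at hlt
    exact ((ENNReal.ofReal_lt_ofReal_iff').1 hlt).1
  simp [h d this] at hd

theorem dimH_Wpsiphi_le {n : ℕ} (hn : 0 < n) {τ σ : ℝ} (hτ : 0 < τ) (hσ : 0 ≤ σ) :
    dimH (Wpsiphi n (fun q => (q : ℝ) ^ (-τ)) (fun q => (q : ℝ) ^ (-σ))) ≤
      ENNReal.ofReal (min (((n : ℝ) + 1) / (1 + τ))
          (((n : ℝ) + 1 + ((n : ℝ) - 1) * σ) / (1 + τ + σ))) := by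
  refine dimH_le_ofReal_of_forall_gt fun s hs => ?_
  rcases min_lt_iff.1 hs with h | h
  · refine measure_mono_null (Wpsiphi_subset_of_le
      (φ' := fun q => (q : ℝ) ^ (-0 : ℝ)) (fun q => by positivity) fun q hq => ?_)
      (hausdorffMeasure_Wpsiphi_eq_zero hn hτ le_rfl (by simpa using h))
    have : (1 : ℝ) ≤ q := by exact_mod_cast hq
    exact Real.rpow_le_rpow_of_exponent_le this (by linarith)
  · exact hausdorffMeasure_Wpsiphi_eq_zero hn hτ hσ h

/-! ### Lower bounds for Hausdorff dimension from nested compact sets -/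

lemma exists_measurable_disjoint_refinement {X ι : Type*} [MeasurableSpace X] [Fintype ι]
    {B : ι → Set X} (hB : ∀ i, MeasurableSet (B i)) :
    ∃ T : ι → Set X, (∀ i, MeasurableSet (T i)) ∧ (∀ i, T i ⊆ B i) ∧
      Pairwise (Function.onFun Disjoint T) ∧ ⋃ i, T i = ⋃ i, B i := by
  let f : Fin (Fintype.card ι) → Set X := B ∘ (Fintype.equivFin ι).symm
  refine ⟨disjointed f ∘ Fintype.equivFin ι, fun i => ?_, fun i => ?_, ?_, ?_⟩
  · exact disjointedRec (p := MeasurableSet) (fun t j ht => ht.diff (hB _)) (hB _)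
  · simpa [f] using disjointed_le f (Fintype.equivFin ι i)
  · exact fun i j hij => disjoint_disjointed f ((Fintype.equivFin ι).injective.ne hij)
  · rw [show ⋃ i, B i = ⋃ j, f j from ((Fintype.equivFin ι).symm.surjective.iUnion_comp B).symm]
    exact ((Fintype.equivFin ι).surjective.iUnion_comp (disjointed f)).trans
      (iSup_disjointed f)

/-- Moving the mass of each piece `T i` by at most `h`, to a measure `ν i` giving mass at most `c` to
the ball `closedBall z r`. -/
lemma sum_smul_closedBall_le {X ι : Type*} [PseudoMetricSpace X] [MeasurableSpace X]
    [Fintype ι] (μ : Measure X) {T : ι → Set X}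
    (hT : ∀ i, MeasurableSet (T i)) (hdisj : Pairwise (Function.onFun Disjoint T))
    {ν : ι → Measure X} {c : ℝ≥0∞} {z : X} {r r' : ℝ}
    (hc : ∀ i, ν i (Metric.closedBall z r) ≤ c)
    (hsupp : ∀ i, ν i (Metric.closedBall z r) ≠ 0 → T i ⊆ Metric.closedBall z r') :
    (∑ i, μ (T i) • ν i) (Metric.closedBall z r) ≤ c * μ (Metric.closedBall z r') := by
  rw [Measure.finsetSum_apply]
  calc ∑ i, (μ (T i) • ν i) (Metric.closedBall z r)
      ≤ ∑ i, c * μ.restrict (Metric.closedBall z r') (T i) := by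
        refine Finset.sum_le_sum fun i _ => ?_
        rw [Measure.smul_apply, smul_eq_mul, mul_comm]
        by_cases h0 : ν i (Metric.closedBall z r) = 0
        · simp [h0]
        · rw [Measure.restrict_apply (hT i), inter_eq_left.2 (hsupp i h0)]
          gcongr
          exact hc i
    _ = c * μ.restrict (Metric.closedBall z r') (⋃ i, T i) := by
        rw [← Finset.mul_sum, measure_iUnion hdisj hT, tsum_fintype]
    _ ≤ c * μ (Metric.closedBall z r') := by
        rw [← Measure.restrict_apply_univ (μ := μ) (Metric.closedBall z r')]
        exact mul_le_mul_right (measure_mono (subset_univ _)) _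

/-- A null set for the Hausdorff measure has open covers by balls with small content. -/
lemma exists_ball_cover_of_hausdorffMeasure_eq_zero {X : Type*} [MetricSpace X] [Nonempty X]
    [MeasurableSpace X] [BorelSpace X] {E : Set X} {s : ℝ} (hs : 0 < s) (hE : μH[s] E = 0)
    {ε : ℝ≥0∞} (hε : ε ≠ 0) :
    ∃ (J : Set ℕ) (z : ℕ → X) (ρ : ℕ → ℝ), (∀ i, 0 < ρ i) ∧
      E ⊆ ⋃ i ∈ J, Metric.ball (z i) (ρ i) ∧ ∑' i : J, ENNReal.ofReal (ρ i ^ s) < ε := by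
  have hε2 : ε / 2 ≠ 0 := by simpa using hε
  rw [Measure.hausdorffMeasure_apply] at hE
  have h1 : (⨅ (t : ℕ → Set X) (_ : E ⊆ ⋃ n, t n) (_ : ∀ n, Metric.ediam (t n) ≤ 1),
      ∑' n, ⨆ _ : (t n).Nonempty, Metric.ediam (t n) ^ s) < ε / 2 := by
    refine lt_of_le_of_lt (le_trans ?_ hE.le) (pos_iff_ne_zero.2 hε2)
    exact le_iSup₂_of_le (1 : ℝ≥0∞) one_pos le_rfl
  simp only [iInf_lt_iff] at h1
  obtain ⟨t, hEt, hdiam, hsum⟩ := h1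
  obtain ⟨e, he, hesum⟩ := ENNReal.exists_pos_sum_of_countable hε2 ℕ
  have hρ : ∀ i, ∃ ρ : ℝ, (Metric.ediam (t i)).toReal < ρ ∧
      ENNReal.ofReal (ρ ^ s) < Metric.ediam (t i) ^ s + e i := by
    intro i
    have hfin : Metric.ediam (t i) ≠ ∞ := ne_top_of_le_ne_top ENNReal.one_ne_top (hdiam i)
    have hcont : Tendsto (fun ρ : ℝ => ENNReal.ofReal (ρ ^ s))
        (𝓝[>] (Metric.ediam (t i)).toReal)
        (𝓝 (ENNReal.ofReal ((Metric.ediam (t i)).toReal ^ s))) :=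
      (ENNReal.tendsto_ofReal
        (Real.continuousAt_rpow_const _ _ (Or.inr hs.le)).tendsto).mono_left nhdsWithin_le_nhds
    have hlt : ENNReal.ofReal ((Metric.ediam (t i)).toReal ^ s) < Metric.ediam (t i) ^ s + e i := by
      rw [← ENNReal.ofReal_rpow_of_nonneg ENNReal.toReal_nonneg hs.le, ENNReal.ofReal_toReal hfin]
      exact ENNReal.lt_add_right (ENNReal.rpow_ne_top_of_nonneg hs.le hfin)
        (by simpa using (he i).ne')
    obtain ⟨ρ, h1, h2⟩ := ((hcont.eventually_lt_const hlt).and self_mem_nhdsWithin).exists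
    exact ⟨ρ, h2, h1⟩
  choose ρ hρ1 hρ2 using hρ
  classical
  refine ⟨{i | (t i).Nonempty}, fun i => if h : (t i).Nonempty then h.some else Classical.arbitrary X, ρ,
    fun i => ENNReal.toReal_nonneg.trans_lt (hρ1 i), ?_, ?_⟩
  · intro x hx
    obtain ⟨i, hi⟩ := mem_iUnion.1 (hEt hx)
    have hne : (t i).Nonempty := ⟨x, hi⟩
    refine mem_iUnion₂.2 ⟨i, hne, ?_⟩
    simp only [hne, dif_pos, Metric.mem_ball]
    refine lt_of_le_of_lt ?_ (hρ1 i)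
    rw [dist_edist]
    exact ENNReal.toReal_mono (ne_top_of_le_ne_top ENNReal.one_ne_top (hdiam i))
      (Metric.edist_le_ediam_of_mem hi hne.some_mem)
  · calc ∑' i : {i | (t i).Nonempty}, ENNReal.ofReal (ρ i ^ s)
        ≤ ∑' i : {i | (t i).Nonempty}, ((⨆ _ : (t i).Nonempty, Metric.ediam (t i) ^ s) + e i) := by
          refine ENNReal.tsum_le_tsum fun i => ?_
          refine (hρ2 i).le.trans ?_
          gcongr
          exact le_iSup_of_le i.2 le_rfl
      _ ≤ ∑' i, ((⨆ _ : (t i).Nonempty, Metric.ediam (t i) ^ s) + e i) :=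
          ENNReal.tsum_comp_le_tsum_of_injective Subtype.val_injective
            (fun i => (⨆ _ : (t i).Nonempty, Metric.ediam (t i) ^ s) + (e i : ℝ≥0∞))
      _ = _ := ENNReal.tsum_add
      _ < ε / 2 + ε / 2 := ENNReal.add_lt_add hsum hesum
      _ = ε := ENNReal.add_halves ε

/-- Mass distribution along a nested sequence of compact sets. -/
lemma le_dimH_of_nested {X : Type*} [MetricSpace X] [MeasurableSpace X] [BorelSpace X]
    {E : Set X} {s C m : ℝ} (hs : 0 < s) (hC : 0 < C) (hm : 0 < m) (V : ℕ → Set X)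
    (hV : ∀ k, IsCompact (V k)) (hanti : Antitone V) (hVE : ⋂ k, V k ⊆ E) (μ : ℕ → Measure X)
    (hsupp : ∀ k, μ k (V k)ᶜ = 0) (hmass : ∀ k, ENNReal.ofReal m < μ k univ)
    (hball : ∀ k z r, 0 < r → μ k (Metric.closedBall z r) ≤ ENNReal.ofReal (C * r ^ s)) :
    ENNReal.ofReal s ≤ dimH E := by
  refine le_dimH_of_hausdorffMeasure_ne_zero (d := s.toNNReal) ?_
  rw [Real.coe_toNNReal s hs.le]
  intro hE
  have hX : Nonempty X := by
    by_contra hX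
    rw [not_nonempty_iff] at hX
    simpa [Set.eq_empty_of_isEmpty (univ : Set X)] using hmass 0
  obtain ⟨J, z, ρ, hρ, hcov, hsum⟩ := exists_ball_cover_of_hausdorffMeasure_eq_zero hs hE
    (ε := ENNReal.ofReal (m / C)) (by simpa using div_pos hm hC)
  obtain ⟨k, hk⟩ := exists_subset_nhds_of_isCompact' (U := ⋃ i ∈ J, Metric.ball (z i) (ρ i))
    hanti.directed_ge hV (fun k => (hV k).isClosed) (fun x hx =>
      (isOpen_biUnion fun i _ => Metric.isOpen_ball).mem_nhds (hcov (hVE hx)))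
  have h1 : μ k univ ≤ ENNReal.ofReal m := by
    calc μ k univ ≤ μ k (V k) + μ k (V k)ᶜ := by
          rw [← union_compl_self (V k)]; exact measure_union_le _ _
      _ ≤ μ k (⋃ i ∈ J, Metric.ball (z i) (ρ i)) := by
          rw [hsupp, add_zero]; exact measure_mono hk
      _ ≤ ∑' i : J, μ k (Metric.ball (z i) (ρ i)) := measure_biUnion_le _ J.to_countable _
      _ ≤ ∑' i : J, ENNReal.ofReal C * ENNReal.ofReal (ρ i ^ s) := by
          refine ENNReal.tsum_le_tsum fun i => ?_
          rw [← ENNReal.ofReal_mul hC.le]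
          exact (measure_mono Metric.ball_subset_closedBall).trans (hball k _ _ (hρ i))
      _ = ENNReal.ofReal C * ∑' i : J, ENNReal.ofReal (ρ i ^ s) := ENNReal.tsum_mul_left
      _ ≤ ENNReal.ofReal C * ENNReal.ofReal (m / C) := by gcongr
      _ = ENNReal.ofReal m := by
          rw [← ENNReal.ofReal_mul hC.le]; congr 1; field_simp
  exact absurd (hmass k) h1.not_gt

/-- Lower bound for the dimension of the limsup set of the open sets `G N`, from the possibility
of pushing a measure into `G N` while preserving a property `P` that implies a Frostman bound. -/
lemma le_dimH_of_step {X : Type*} [MetricSpace X] [LocallyCompactSpace X] [MeasurableSpace X]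
    [BorelSpace X] {E V₀ : Set X} {s C m : ℝ} (hs : 0 < s) (hC : 0 < C) (hm : 0 < m)
    (P : Measure X → Set X → Prop) (G : ℕ → Set X) (hG : ∀ N, IsOpen (G N)) (hV₀ : IsCompact V₀)
    (hE : ∀ x ∈ V₀, (∀ N, x ∈ G N) → x ∈ E)
    (hcomp : ∀ μ K, P μ K → IsCompact K) (hsupp : ∀ μ K, P μ K → μ Kᶜ = 0)
    (hmass : ∀ μ K, P μ K → ENNReal.ofReal m < μ univ)
    (hball : ∀ μ K, P μ K → ∀ z r, 0 < r →
      μ (Metric.closedBall z r) ≤ ENNReal.ofReal (C * r ^ s))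
    (hinit : ∃ μ K, P μ K ∧ K ⊆ interior V₀)
    (hstep : ∀ μ K U N, P μ K → IsOpen U → K ⊆ U → U ⊆ V₀ →
      ∃ μ' K', P μ' K' ∧ K' ⊆ U ∩ G N) :
    ENNReal.ofReal s ≤ dimH E := by
  let S := {a : Measure X × Set X × Set X //
    P a.1 a.2.1 ∧ IsCompact a.2.2 ∧ a.2.1 ⊆ interior a.2.2 ∧ a.2.2 ⊆ V₀}
  have hnext : ∀ (a : S) (N : ℕ), ∃ b : S, b.1.2.2 ⊆ a.1.2.2 ∩ G N := by
    rintro ⟨⟨μ, K, V⟩, hP, hV, hKV, hVV₀⟩ N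
    obtain ⟨μ', K', hP', hK'⟩ := hstep μ K (interior V) N hP isOpen_interior hKV
      (interior_subset.trans hVV₀)
    obtain ⟨L, hL, hKL, hLU⟩ := exists_compact_between (hcomp _ _ hP')
      (isOpen_interior.inter (hG N)) hK'
    have hLV : L ⊆ V ∩ G N := hLU.trans (inter_subset_inter_left _ interior_subset)
    exact ⟨⟨⟨μ', K', L⟩, hP', hL, hKL, (hLV.trans inter_subset_left).trans hVV₀⟩, hLV⟩
  choose f hf using hnext
  obtain ⟨μ₀, K₀, hP₀, hK₀⟩ := hinit
  let a : ℕ → S := fun k => Nat.rec ⟨⟨μ₀, K₀, V₀⟩, hP₀, hV₀, hK₀, subset_rfl⟩ (fun N b => f b N) k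
  have ha : ∀ k, (a (k + 1)).1.2.2 ⊆ (a k).1.2.2 ∩ G k := fun k => hf (a k) k
  refine le_dimH_of_nested hs hC hm (fun k => (a k).1.2.2) (fun k => (a k).2.2.1)
    (antitone_nat_of_succ_le fun k => (ha k).trans inter_subset_left) (fun x hx => ?_)
    (fun k => (a k).1.1) (fun k => ?_) (fun k => hmass _ _ (a k).2.1)
    (fun k => hball _ _ (a k).2.1)
  · rw [mem_iInter] at hx
    exact hE x (hx 0) fun N => (ha N (hx (N + 1))).2
  · refine measure_mono_null (compl_subset_compl.2 ?_) (hsupp _ _ (a k).2.1)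
    exact (a k).2.2.2.1.trans interior_subset

/-! ### Boxes inside annuli -/

/-- Displacement of the lower corner of `annulusBox`. -/
noncomputable def boxLo {n : ℕ} (j : Fin n) (R w : ℝ) (k : Fin n) : ℝ :=
  if k = j then R - 3 * w / 4 else -(R / 2)

/-- Displacement of the upper corner of `annulusBox`. -/
noncomputable def boxHi {n : ℕ} (j : Fin n) (R w : ℝ) (k : Fin n) : ℝ :=
  if k = j then R - w / 4 else R / 2

/-- A compact box contained in the annulus `R - w < ‖x - y‖ < R`, on the face in direction `j`. -/
noncomputable def annulusBox {n : ℕ} (j : Fin n) (y : Fin n → ℝ) (R w : ℝ) : Set (Fin n → ℝ) :=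
  Icc (y + boxLo j R w) (y + boxHi j R w)

lemma isCompact_annulusBox {n : ℕ} (j : Fin n) (y : Fin n → ℝ) (R w : ℝ) :
    IsCompact (annulusBox j y R w) := isCompact_Icc

lemma norm_sub_lt_of_mem_annulusBox {n : ℕ} {j : Fin n} {x y : Fin n → ℝ} {R w : ℝ} (hw : 0 < w)
    (hwR : w ≤ R / 2) (hx : x ∈ annulusBox j y R w) : R - w < ‖x - y‖ ∧ ‖x - y‖ < R := by
  have h1 := fun k => hx.1 k
  have h2 := fun k => hx.2 k
  simp only [Pi.add_apply, boxLo, boxHi] at h1 h2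
  constructor
  · have hj := h1 j
    rw [if_pos rfl] at hj
    have := norm_le_pi_norm (x - y) j
    rw [Pi.sub_apply, Real.norm_eq_abs] at this
    linarith [le_abs_self (x j - y j)]
  · refine (pi_norm_lt_iff (by linarith)).2 fun k => ?_
    rw [Pi.sub_apply, Real.norm_eq_abs, abs_lt]
    have ha := h1 k
    have hb := h2 k
    split_ifs at ha hb <;> constructor <;> linarith

/-- Side lengths of `annulusBox`. -/
noncomputable def boxSide {n : ℕ} (j : Fin n) (R w : ℝ) (k : Fin n) : ℝ :=
  if k = j then w / 2 else R

lemma boxHi_sub_boxLo {n : ℕ} (j : Fin n) (R w : ℝ) (k : Fin n) :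
    boxHi j R w k - boxLo j R w k = boxSide j R w k := by
  unfold boxHi boxLo boxSide
  split_ifs <;> ring

lemma boxSide_pos {n : ℕ} {j : Fin n} {R w : ℝ} (hw : 0 < w) (hR : 0 < R) (k : Fin n) :
    0 < boxSide j R w k := by
  unfold boxSide
  split_ifs <;> linarith

lemma volume_annulusBox {n : ℕ} (j : Fin n) (y : Fin n → ℝ) {R w : ℝ} (hw : 0 < w) (hR : 0 < R) :
    volume (annulusBox j y R w) = ENNReal.ofReal (∏ k, boxSide j R w k) := by
  rw [annulusBox, Real.volume_Icc_pi,
    ENNReal.ofReal_prod_of_nonneg fun k _ => (boxSide_pos hw hR k).le]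
  refine Finset.prod_congr rfl fun k _ => ?_
  rw [← boxHi_sub_boxLo]
  simp

lemma volume_annulusBox_inter_closedBall_le {n : ℕ} (j : Fin n) (y z : Fin n → ℝ) {R w r : ℝ}
    (hw : 0 < w) (hR : 0 < R) (hr : 0 < r) :
    volume (annulusBox j y R w ∩ Metric.closedBall z r) ≤
      ENNReal.ofReal (∏ k, min (boxSide j R w k) (2 * r)) := by
  rw [annulusBox, closedBall_pi z hr.le]
  simp only [Real.closedBall_eq_Icc]
  rw [Set.pi_univ_Icc, Icc_inter_Icc, Real.volume_Icc_pi,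
    ENNReal.ofReal_prod_of_nonneg fun k _ => le_min (boxSide_pos hw hR k).le (by linarith)]
  refine Finset.prod_le_prod' fun k _ => ENNReal.ofReal_le_ofReal ?_
  rw [← boxHi_sub_boxLo]
  simp only [Pi.sup_apply, Pi.inf_apply, Pi.add_apply]
  refine le_min ?_ ?_
  · linarith [le_max_left (y k + boxLo j R w k) (z k - r), min_le_left (y k + boxHi j R w k) (z k + r)]
  · linarith [le_max_right (y k + boxLo j R w k) (z k - r),
      min_le_right (y k + boxHi j R w k) (z k + r)]

lemma min_one_pow_le_rpow {t β : ℝ} {m : ℕ} (ht : 0 < t) (hβ : 0 ≤ β) (hβm : β ≤ m) :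
    (min 1 t) ^ m ≤ t ^ β := by
  rcases le_total 1 t with h | h
  · rw [min_eq_left h, one_pow]
    exact Real.one_le_rpow h hβ
  · rw [min_eq_right h, ← Real.rpow_natCast]
    exact Real.rpow_le_rpow_of_exponent_ge ht h hβm

/-- The uniform probability measure on a box gives small mass to small balls. -/
lemma cond_annulusBox_closedBall_le {n : ℕ} (j : Fin n) (y z : Fin n → ℝ) {R w R₀ w₀ r α β : ℝ}
    (hw₀ : 0 < w₀) (hw : w₀ ≤ w) (hR₀ : 0 < R₀) (hR : R₀ ≤ R) (hr : 0 < r)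
    (hα : 0 ≤ α) (hα1 : α ≤ 1) (hβ : 0 ≤ β) (hβn : β ≤ n - 1) :
    ProbabilityTheory.cond volume (annulusBox j y R w) (Metric.closedBall z r) ≤
      ENNReal.ofReal ((4 * r / w₀) ^ α * (2 * r / R₀) ^ β) := by
  have hwp := hw₀.trans_le hw
  have hRp := hR₀.trans_le hR
  have hn : 1 ≤ n := j.pos
  have hpos : 0 < ∏ k, boxSide j R w k := Finset.prod_pos fun k _ => boxSide_pos hwp hRp k
  rw [ProbabilityTheory.cond_apply (isCompact_annulusBox j y R w).measurableSet,
    volume_annulusBox j y hwp hRp, ← ENNReal.ofReal_inv_of_pos hpos]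
  refine (mul_le_mul_right (volume_annulusBox_inter_closedBall_le j y z hwp hRp hr) _).trans ?_
  rw [← ENNReal.ofReal_mul (inv_nonneg.2 hpos.le)]
  refine ENNReal.ofReal_le_ofReal ?_
  rw [← Finset.prod_inv_distrib, ← Finset.prod_mul_distrib,
    ← Finset.mul_prod_erase Finset.univ _ (Finset.mem_univ j)]
  have e : ∀ a : ℝ, 0 < a → a⁻¹ * min a (2 * r) = min 1 (2 * r / a) := fun a ha => by
    rw [mul_min_of_nonneg _ _ (inv_nonneg.2 ha.le), inv_mul_cancel₀ ha.ne', inv_mul_eq_div]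
  have h1 : (boxSide j R w j)⁻¹ * min (boxSide j R w j) (2 * r) ≤ (4 * r / w₀) ^ α := by
    rw [e _ (boxSide_pos hwp hRp j), boxSide, if_pos rfl, show 2 * r / (w / 2) = 4 * r / w by
      field_simp; ring, ← pow_one (min 1 _)]
    refine (min_one_pow_le_rpow (by positivity) hα (by simpa using hα1)).trans ?_
    gcongr
  have h2 : ∏ k ∈ Finset.univ.erase j, (boxSide j R w k)⁻¹ * min (boxSide j R w k) (2 * r) ≤
      (2 * r / R₀) ^ β := by
    rw [Finset.prod_congr rfl (g := fun _ => min 1 (2 * r / R)) fun k hk => by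
      rw [e _ (boxSide_pos hwp hRp k), boxSide, if_neg (Finset.ne_of_mem_erase hk)]]
    rw [Finset.prod_const, Finset.card_erase_of_mem (Finset.mem_univ j), Finset.card_univ,
      Fintype.card_fin]
    refine (min_one_pow_le_rpow (by positivity) hβ ?_).trans ?_
    · rw [Nat.cast_sub hn, Nat.cast_one]; exact hβn
    · gcongr
  refine mul_le_mul h1 h2 (Finset.prod_nonneg fun k _ => ?_) (by positivity)
  have := boxSide_pos (j := j) hwp hRp k
  positivity

/-! ### Dirichlet's theorem and points with small denominators -/

/-- Dirichlet's simultaneous approximation theorem. -/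
lemma exists_rat_approx {n : ℕ} (x : Fin n → ℝ) {T : ℕ} (hT : 0 < T) :
    ∃ q : ℕ, 0 < q ∧ q ≤ T ^ n ∧ ∃ p : Fin n → ℤ,
      ‖x - fun i => (p i : ℝ) / q‖ ≤ 1 / (T * q : ℝ) := by
  have hT' : (0 : ℝ) < T := by exact_mod_cast hT
  have hfl : ∀ (j : ℕ) (i : Fin n), ⌊(T : ℝ) * Int.fract (j * x i)⌋₊ < T := fun j i => by
    rw [Nat.floor_lt (mul_nonneg hT'.le (Int.fract_nonneg _))]
    exact mul_lt_of_lt_one_right hT' (Int.fract_lt_one _)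
  let f : Fin (T ^ n + 1) → Fin n → Fin T := fun j i =>
    ⟨⌊(T : ℝ) * Int.fract ((j : ℕ) * x i)⌋₊, hfl j i⟩
  obtain ⟨a, b, hab, hf⟩ : ∃ a b, a < b ∧ f a = f b := by
    obtain ⟨a, b, hne, h⟩ := Fintype.exists_ne_map_eq_of_card_lt f (by simp)
    rcases lt_or_gt_of_ne hne with h1 | h1
    exacts [⟨a, b, h1, h⟩, ⟨b, a, h1, h.symm⟩]
  have hab' : (a : ℕ) < b := hab
  have hq : 0 < (b : ℕ) - a := by omega
  have hq' : (0 : ℝ) < ((b - a : ℕ) : ℝ) := by exact_mod_cast hq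
  refine ⟨b - a, hq, by have := b.2; omega, fun i => ⌊(b : ℕ) * x i⌋ - ⌊(a : ℕ) * x i⌋, ?_⟩
  refine (pi_norm_le_iff_of_nonneg (by positivity)).2 fun i => ?_
  have hi : ⌊(T : ℝ) * Int.fract ((a : ℕ) * x i)⌋₊ = ⌊(T : ℝ) * Int.fract ((b : ℕ) * x i)⌋₊ :=
    congrArg Fin.val (congrFun hf i)
  have key : |(T : ℝ) * Int.fract ((b : ℕ) * x i) - T * Int.fract ((a : ℕ) * x i)| ≤ 1 := by
    have a1 := Nat.floor_le (mul_nonneg hT'.le (Int.fract_nonneg ((a : ℕ) * x i)))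
    have a2 := Nat.lt_floor_add_one ((T : ℝ) * Int.fract ((a : ℕ) * x i))
    have b1 := Nat.floor_le (mul_nonneg hT'.le (Int.fract_nonneg ((b : ℕ) * x i)))
    have b2 := Nat.lt_floor_add_one ((T : ℝ) * Int.fract ((b : ℕ) * x i))
    rw [hi] at a1 a2
    rw [abs_le]
    constructor <;> linarith
  rw [← mul_sub, abs_mul, abs_of_pos hT', ← Int.self_sub_floor, ← Int.self_sub_floor] at key
  rw [Pi.sub_apply, Real.norm_eq_abs, le_div_iff₀ (by positivity)]
  refine le_trans (le_of_eq ?_) key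
  rw [mul_left_comm, ← abs_of_pos hq', ← abs_mul, abs_of_pos hq']
  congr 2
  rw [sub_mul, div_mul_cancel₀ _ hq'.ne', Nat.cast_sub hab'.le]
  push_cast
  ring

/-- The points that are approximated as well as in Dirichlet's theorem by a rational point with
small denominator form a set of small measure. -/
lemma volume_small_denominator_le {n : ℕ} {T : ℕ} (hT : 2 ≤ T) {a : ℝ} (ha : 0 ≤ a) :
    volume {x ∈ unitCube n | ∃ q : ℕ, 0 < q ∧ (q : ℝ) ≤ a * T ^ n ∧ ∃ p : Fin n → ℤ,
      ‖x - fun i => (p i : ℝ) / q‖ ≤ 1 / (T * q : ℝ)} ≤ ENNReal.ofReal (8 ^ n * a) := by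
  have hT' : (2 : ℝ) ≤ T := by exact_mod_cast hT
  set b := ⌊a * (T : ℝ) ^ n⌋₊ with hb
  have hsub : {x ∈ unitCube n | ∃ q : ℕ, 0 < q ∧ (q : ℝ) ≤ a * T ^ n ∧ ∃ p : Fin n → ℤ,
      ‖x - fun i => (p i : ℝ) / q‖ ≤ 1 / (T * q : ℝ)} ⊆
      ⋃ q ∈ Finset.Icc 1 b, ⋃ p ∈ Fintype.piFinset fun _ : Fin n => Finset.Icc (-q : ℤ) (2 * q),
        Metric.closedBall (fun i => (p i : ℝ) / q) (1 / (T * q : ℝ)) := by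
    rintro x ⟨hx, q, hq, hqa, p, hp⟩
    have hq1 : (1 : ℝ) ≤ q := by exact_mod_cast hq
    refine mem_iUnion₂.2 ⟨q, Finset.mem_Icc.2 ⟨hq, Nat.le_floor hqa⟩, mem_iUnion₂.2 ⟨p, ?_, ?_⟩⟩
    · rw [Fintype.mem_piFinset]
      intro i
      refine num_mem_Icc_of_abs_sub_lt_one (hx i (mem_univ i)) hq ?_
      refine lt_of_le_of_lt ((norm_le_pi_norm (x - fun i => (p i : ℝ) / q) i).trans hp) ?_
      rw [div_lt_one (by positivity)]
      nlinarith
    · rwa [Metric.mem_closedBall, dist_eq_norm]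
  refine (measure_mono hsub).trans ((measure_biUnion_finset_le _ _).trans ?_)
  have hq : ∀ q ∈ Finset.Icc 1 b, volume (⋃ p ∈ Fintype.piFinset fun _ : Fin n =>
      Finset.Icc (-q : ℤ) (2 * q), Metric.closedBall (fun i => (p i : ℝ) / q) (1 / (T * q : ℝ))) ≤
      ENNReal.ofReal ((8 / T) ^ n) := by
    intro q hq
    have hq1 : (1 : ℝ) ≤ q := by exact_mod_cast (Finset.mem_Icc.1 hq).1
    refine (measure_biUnion_finset_le _ _).trans ?_
    simp only [Real.volume_pi_closedBall _ (show (0 : ℝ) ≤ 1 / (T * q : ℝ) by positivity),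
      Finset.sum_const, Fintype.card_piFinset, Int.card_Icc, Finset.prod_const, Finset.card_univ,
      Fintype.card_fin]
    rw [show (2 * (q : ℤ) + 1 - -(q : ℤ)).toNat = 3 * q + 1 by omega, nsmul_eq_mul,
      ← ENNReal.ofReal_natCast, ← ENNReal.ofReal_mul (by positivity)]
    refine ENNReal.ofReal_le_ofReal ?_
    push_cast
    rw [← mul_pow]
    gcongr
    rw [← mul_div_assoc, ← mul_div_assoc, div_le_div_iff₀ (by positivity) (by positivity)]
    nlinarith
  refine (Finset.sum_le_sum hq).trans ?_
  rw [Finset.sum_const, Nat.card_Icc, nsmul_eq_mul, ← ENNReal.ofReal_natCast,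
    ← ENNReal.ofReal_mul (by positivity), Nat.add_sub_cancel]
  refine ENNReal.ofReal_le_ofReal ?_
  have : (b : ℝ) ≤ a * T ^ n := Nat.floor_le (by positivity)
  calc (b : ℝ) * (8 / T) ^ n ≤ a * T ^ n * (8 / T) ^ n := by gcongr
    _ = 8 ^ n * a := by rw [div_pow]; field_simp

/-! ### Transporting mass to the annuli around rational points -/

lemma min_mul_pow_le {n : ℕ} {τ σ α β A T r : ℝ} (hα : 0 ≤ α) (hβ : 0 ≤ β) (hαβ : α + β ≤ n)
    (hexp : (1 + τ + σ) * α + (1 + τ) * β ≤ n + 1) (hA : 0 ≤ A) (hT : 1 ≤ T) (hr : 0 < r)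
    (hr1 : r ≤ 1) :
    min 1 ((4 * r / (T ^ n) ^ (-(1 + τ + σ))) ^ α * (2 * r / (T ^ n) ^ (-(1 + τ))) ^ β) *
      (2 * (r + A * (T ^ (n + 1))⁻¹)) ^ n ≤
      (4 ^ α * 2 ^ β * (2 * (1 + A)) ^ n) * r ^ (α + β) := by
  have hT0 : 0 < T := by linarith
  have h4 : (1 : ℝ) ≤ 4 ^ α := Real.one_le_rpow (by norm_num) hα
  have h2 : (1 : ℝ) ≤ 2 ^ β := Real.one_le_rpow (by norm_num) hβ
  have h42 : (1 : ℝ) ≤ 4 ^ α * 2 ^ β := one_le_mul_of_one_le_of_one_le h4 h2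
  have hQ : 1 ≤ T ^ n := one_le_pow₀ hT
  set Q := T ^ n with hQdef
  have hQ0 : 0 < Q := by linarith
  set L := (T ^ (n + 1))⁻¹ with hL
  have hL0 : 0 < L := by positivity
  rcases le_or_gt L r with h | h
  · calc _ ≤ 1 * (2 * (r + A * r)) ^ n := by
          gcongr
          exact min_le_left _ _
      _ = 1 * (2 * (1 + A)) ^ n * r ^ (n : ℝ) := by
          rw [Real.rpow_natCast, mul_assoc, ← mul_pow]; ring
      _ ≤ _ := by
          exact mul_le_mul (mul_le_mul_of_nonneg_right h42 (by positivity))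
            (Real.rpow_le_rpow_of_exponent_ge hr hr1 hαβ) (by positivity) (by positivity)
  · have hLn : L ^ n = Q ^ (-((n : ℝ) + 1)) := by
      rw [hL, hQdef, Real.rpow_neg (by positivity), inv_pow, ← pow_mul, ← Nat.cast_succ,
        Real.rpow_natCast, ← pow_mul, mul_comm]
    calc _ ≤ ((4 * r / Q ^ (-(1 + τ + σ))) ^ α * (2 * r / Q ^ (-(1 + τ))) ^ β) *
          (2 * (L + A * L)) ^ n := by
          gcongr
          exact min_le_right _ _
      _ = (4 ^ α * 2 ^ β * (2 * (1 + A)) ^ n) * r ^ (α + β) *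
          Q ^ ((1 + τ + σ) * α + (1 + τ) * β - (n + 1)) := by
          rw [show 2 * (L + A * L) = 2 * (1 + A) * L by ring, mul_pow _ L, hLn,
            Real.div_rpow (by positivity) (by positivity),
            Real.div_rpow (by positivity) (by positivity), Real.mul_rpow (by norm_num) hr.le,
            Real.mul_rpow (by norm_num) hr.le, ← Real.rpow_mul hQ0.le, ← Real.rpow_mul hQ0.le,
            Real.rpow_add hr, sub_eq_add_neg, Real.rpow_add hQ0, Real.rpow_add hQ0, neg_mul,
            neg_mul, Real.rpow_neg hQ0.le, Real.rpow_neg hQ0.le, div_inv_eq_mul, div_inv_eq_mul]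
          ring
      _ ≤ _ := mul_le_of_le_one_right (by positivity)
          (Real.rpow_le_one_of_one_le_of_nonpos hQ (by linarith))

lemma finite_rational_near {n T : ℕ} {K : Set (Fin n → ℝ)} (hT : 2 ≤ T) (hK : K ⊆ unitCube n) :
    {pq : (Fin n → ℤ) × ℕ | 0 < pq.2 ∧ pq.2 ≤ T ^ n ∧
      (Metric.closedBall (fun i => (pq.1 i : ℝ) / pq.2) (1 / (T * pq.2 : ℝ)) ∩ K).Nonempty}.Finite := by
  refine Set.Finite.subset (Finset.finite_toSet
    ((Fintype.piFinset fun _ : Fin n => Finset.Icc (-(T ^ n : ℕ) : ℤ) (2 * (T ^ n : ℕ))) ×ˢ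
      Finset.Icc 1 (T ^ n))) ?_
  rintro ⟨p, q⟩ ⟨hq, hqT, x, hx, hxK⟩
  simp only at hq hqT hx
  simp only [Finset.coe_product, Set.mem_prod, Finset.mem_coe, Fintype.mem_piFinset,
    Finset.mem_Icc]
  refine ⟨fun i => ?_, hq, hqT⟩
  have hT' : (2 : ℝ) ≤ T := by exact_mod_cast hT
  have hq' : (1 : ℝ) ≤ q := by exact_mod_cast hq
  have h1 : 1 / (T * q : ℝ) < 1 := by
    rw [div_lt_one (by positivity)]; nlinarith
  have hb : |x i - p i / q| < 1 :=
    ((norm_le_pi_norm (x - fun i => (p i : ℝ) / q) i).trans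
      (mem_closedBall_iff_norm.1 hx)).trans_lt h1
  have := num_mem_Icc_of_abs_sub_lt_one (hK hxK i (mem_univ i)) hq hb
  rw [Finset.mem_Icc] at this
  omega

/-- Mass transport from `μ` to the annuli around the rational points of denominator comparable to
`T ^ n`. -/
lemma exists_transport {n : ℕ} (hn : 0 < n) {τ σ α β a : ℝ} (hτ : (1 : ℝ) / n ≤ τ) (hσ : 0 < σ)
    (hα : 0 ≤ α) (hα1 : α ≤ 1) (hβ : 0 ≤ β) (hβn : β ≤ n - 1) (ha : 0 < a)
    {μ : Measure (Fin n → ℝ)} [IsFiniteMeasure μ] {K : Set (Fin n → ℝ)} (hK : K ⊆ unitCube n)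
    (hμK : μ Kᶜ = 0) {M : ℝ≥0} (hM : ∀ A, μ A ≤ M * volume A) {T : ℕ} (hT : 2 ≤ T)
    (hσT : (a * (T : ℝ) ^ n) ^ (-σ) ≤ 1 / 2) {h : ℝ}
    (hh : h = (a⁻¹ + a ^ (-(1 + τ))) * ((T : ℝ) ^ (n + 1))⁻¹) :
    ∃ (ν : Measure (Fin n → ℝ)) (K' : Set (Fin n → ℝ)), IsCompact K' ∧ ν K'ᶜ = 0 ∧
      (∃ M' : ℝ≥0, ∀ A, ν A ≤ M' * volume A) ∧
      μ univ ≤ ν univ + M * ENNReal.ofReal (8 ^ n * a) ∧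
      (∀ x ∈ K', ∃ y ∈ K, dist x y ≤ h) ∧
      (∀ x ∈ K', ∃ (p : Fin n → ℤ) (q : ℕ), 0 < q ∧ a * T ^ n < q ∧
        (1 - (q : ℝ) ^ (-σ)) * ((q : ℝ) ^ (-τ) / q) < ‖x - fun i => (p i : ℝ) / q‖ ∧
        ‖x - fun i => (p i : ℝ) / q‖ < (q : ℝ) ^ (-τ) / q) ∧
      ∀ z r, 0 < r → ν (Metric.closedBall z r) ≤
        ENNReal.ofReal (min 1 ((4 * r / ((T : ℝ) ^ n) ^ (-(1 + τ + σ))) ^ α *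
          (2 * r / ((T : ℝ) ^ n) ^ (-(1 + τ))) ^ β)) * μ (Metric.closedBall z (r + h)) := by
  have hn' : (0 : ℝ) < n := by exact_mod_cast hn
  have hτ0 : 0 < τ := lt_of_lt_of_le (by positivity) hτ
  have hT' : (2 : ℝ) ≤ T := by exact_mod_cast hT
  have hT0 : (0 : ℝ) < T := by linarith
  set Q : ℝ := (T : ℝ) ^ n with hQ
  have hQ0 : 0 < Q := by positivity
  set L : ℝ := ((T : ℝ) ^ (n + 1))⁻¹ with hL
  have hL0 : 0 < L := by positivity
  have hτn : (1 : ℝ) ≤ n * τ := by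
    rw [div_le_iff₀ hn'] at hτ; linarith
  have hQL : Q ^ (-(1 + τ)) ≤ L := by
    rw [hL, hQ, ← Real.rpow_natCast, ← Real.rpow_natCast, ← Real.rpow_neg hT0.le,
      ← Real.rpow_mul hT0.le]
    refine Real.rpow_le_rpow_of_exponent_le (by linarith) ?_
    push_cast
    nlinarith
  let y : (Fin n → ℤ) × ℕ → Fin n → ℝ := fun pq i => (pq.1 i : ℝ) / pq.2
  let J : Set ((Fin n → ℤ) × ℕ) := {pq | 0 < pq.2 ∧ pq.2 ≤ T ^ n ∧
      (Metric.closedBall (y pq) (1 / (T * pq.2 : ℝ)) ∩ K).Nonempty} ∩ {pq | a * Q < pq.2}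
  have hJ : J.Finite := (finite_rational_near hT hK).inter_of_left _
  have : Fintype J := hJ.fintype
  let ρ : J → ℝ := fun i => 1 / (T * i.1.2 : ℝ)
  let R : J → ℝ := fun i => (i.1.2 : ℝ) ^ (-τ) / i.1.2
  let w : J → ℝ := fun i => (i.1.2 : ℝ) ^ (-σ) * R i
  have hq0 : ∀ i : J, (0 : ℝ) < i.1.2 := fun i => by exact_mod_cast i.2.1.1
  have hqQ : ∀ i : J, (i.1.2 : ℝ) ≤ Q := fun i => by rw [hQ]; exact_mod_cast i.2.1.2.1
  have haq : ∀ i : J, a * Q < i.1.2 := fun i => i.2.2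
  have hR_eq : ∀ i, R i = (i.1.2 : ℝ) ^ (-(1 + τ)) := fun i => by
    simp only [R]
    rw [← Real.rpow_sub_one (hq0 i).ne']; congr 1; ring
  have hw_eq : ∀ i, w i = (i.1.2 : ℝ) ^ (-(1 + τ + σ)) := fun i => by
    simp only [w]
    rw [hR_eq, ← Real.rpow_add (hq0 i)]; congr 1; ring
  have hRpos : ∀ i, 0 < R i := fun i => by have := hq0 i; positivity
  have hwpos : ∀ i, 0 < w i := fun i => by have := hq0 i; have := hRpos i; positivity
  have hR_ge : ∀ i, Q ^ (-(1 + τ)) ≤ R i := fun i => by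
    rw [hR_eq]
    exact Real.rpow_le_rpow_of_nonpos (hq0 i) (hqQ i) (by linarith)
  have hw_ge : ∀ i, Q ^ (-(1 + τ + σ)) ≤ w i := fun i => by
    rw [hw_eq]
    exact Real.rpow_le_rpow_of_nonpos (hq0 i) (hqQ i) (by linarith)
  have hwR : ∀ i, w i ≤ R i / 2 := fun i => by
    have : (i.1.2 : ℝ) ^ (-σ) ≤ 1 / 2 :=
      (Real.rpow_le_rpow_of_nonpos (by positivity) (haq i).le (by linarith)).trans hσT
    have := mul_le_mul_of_nonneg_right this (hRpos i).le
    simp only [w]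
    linarith
  have hRh : ∀ i, ρ i + R i ≤ h := fun i => by
    have h1 : ρ i ≤ a⁻¹ * L := by
      have : a⁻¹ * L = 1 / (T * (a * Q)) := by
        rw [hL, hQ]; field_simp; ring
      rw [this]
      exact one_div_le_one_div_of_le (by positivity)
        (mul_le_mul_of_nonneg_left (haq i).le hT0.le)
    have h2 : R i ≤ a ^ (-(1 + τ)) * L := by
      rw [hR_eq]
      calc _ ≤ (a * Q) ^ (-(1 + τ)) :=
            Real.rpow_le_rpow_of_nonpos (by positivity) (haq i).le (by linarith)
        _ = a ^ (-(1 + τ)) * Q ^ (-(1 + τ)) := Real.mul_rpow ha.le hQ0.le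
        _ ≤ _ := by gcongr
    rw [hh]; linarith
  obtain ⟨P, hPm, hPsub, hPdisj, hPun⟩ := exists_measurable_disjoint_refinement
    (B := fun i : J => Metric.closedBall (y i) (ρ i)) fun i => Metric.isClosed_closedBall.measurableSet
  let b : J → Set (Fin n → ℝ) := fun i => annulusBox ⟨0, hn⟩ (y i) (R i) (w i)
  have hbm : ∀ i, IsCompact (b i) := fun i => isCompact_annulusBox _ _ _ _
  have hbvol : ∀ i, volume (b i) ≠ 0 ∧ volume (b i) ≠ ∞ := fun i => by
    simp only [b]
    rw [volume_annulusBox _ _ (hwpos i) (hRpos i)]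
    exact ⟨(ENNReal.ofReal_pos.2 (Finset.prod_pos fun k _ =>
      boxSide_pos (hwpos i) (hRpos i) k)).ne', ENNReal.ofReal_ne_top⟩
  have hprob : ∀ i, IsProbabilityMeasure (ProbabilityTheory.cond volume (b i)) := fun i =>
    ProbabilityTheory.cond_isProbabilityMeasure_of_finite (hbvol i).1 (hbvol i).2
  have hbmem : ∀ i, ∀ x ∈ b i, R i - w i < ‖x - y i‖ ∧ ‖x - y i‖ < R i := fun i x hx =>
    norm_sub_lt_of_mem_annulusBox (hwpos i) (hwR i) hx
  refine ⟨∑ i, μ (P i) • ProbabilityTheory.cond volume (b i), ⋃ i, b i,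
    isCompact_iUnion hbm, ?_, ?_, ?_, ?_, ?_, ?_⟩
  · rw [Measure.finsetSum_apply]
    refine Finset.sum_eq_zero fun i _ => ?_
    rw [Measure.smul_apply, smul_eq_mul]
    refine mul_eq_zero_of_right _ (measure_mono_null (compl_subset_compl.2 (subset_iUnion b i)) ?_)
    rw [ProbabilityTheory.cond_apply (hbm i).measurableSet, inter_compl_self]
    simp
  · have hfin : ∑ i, μ (P i) * (volume (b i))⁻¹ ≠ ∞ :=
      (ENNReal.sum_lt_top.2 fun i _ => ENNReal.mul_lt_top (measure_lt_top _ _)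
        (ENNReal.inv_lt_top.2 (pos_iff_ne_zero.2 (hbvol i).1))).ne
    refine ⟨(∑ i, μ (P i) * (volume (b i))⁻¹).toNNReal, fun A => ?_⟩
    rw [ENNReal.coe_toNNReal hfin, Measure.finsetSum_apply, Finset.sum_mul]
    refine Finset.sum_le_sum fun i _ => ?_
    rw [Measure.smul_apply, smul_eq_mul, mul_assoc,
      ProbabilityTheory.cond_apply (hbm i).measurableSet]
    gcongr
    exact inter_subset_right
  · have htot : (∑ i, μ (P i) • ProbabilityTheory.cond volume (b i)) univ = μ (⋃ i, P i) := by
      rw [Measure.finsetSum_apply, measure_iUnion hPdisj hPm, tsum_fintype]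
      refine Finset.sum_congr rfl fun i _ => ?_
      have := hprob i
      rw [Measure.smul_apply, measure_univ, smul_eq_mul, mul_one]
    rw [htot, hPun]
    have hcover : (univ : Set (Fin n → ℝ)) ⊆ Kᶜ ∪ ((⋃ i : J, Metric.closedBall (y i) (ρ i)) ∪
        {x ∈ unitCube n | ∃ q : ℕ, 0 < q ∧ (q : ℝ) ≤ a * T ^ n ∧ ∃ p : Fin n → ℤ,
          ‖x - fun i => (p i : ℝ) / q‖ ≤ 1 / (T * q : ℝ)}) := by
      intro x _
      by_cases hx : x ∈ K
      swap
      · exact Or.inl hx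
      right
      obtain ⟨q, hq, hqT, p, hp⟩ := exists_rat_approx x (by omega : 0 < T)
      rcases le_or_gt (q : ℝ) (a * T ^ n) with hqa | hqa
      · exact Or.inr ⟨hK hx, q, hq, hqa, p, hp⟩
      · have hxb := mem_closedBall_iff_norm.2 hp
        exact Or.inl (mem_iUnion.2 ⟨⟨(p, q), ⟨hq, hqT, x, hxb, hx⟩, hqa⟩, hxb⟩)
    calc μ univ ≤ μ Kᶜ + (μ (⋃ i : J, Metric.closedBall (y i) (ρ i)) + μ _) :=
          (measure_mono hcover).trans ((measure_union_le _ _).trans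
            (add_le_add le_rfl (measure_union_le _ _)))
      _ ≤ _ := by
          rw [hμK, zero_add]
          gcongr
          exact (hM _).trans (by gcongr; exact volume_small_denominator_le hT ha.le)
  · intro x hx
    obtain ⟨i, hi⟩ := mem_iUnion.1 hx
    obtain ⟨k, hk, hkK⟩ := i.2.1.2.2
    refine ⟨k, hkK, (dist_triangle_right x k (y i)).trans ?_⟩
    have h1 : dist x (y i) < R i := by rw [dist_eq_norm]; exact (hbmem i x hi).2
    have h2 : dist k (y i) ≤ ρ i := Metric.mem_closedBall.1 hk
    linarith [hRh i]
  · intro x hx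
    obtain ⟨i, hi⟩ := mem_iUnion.1 hx
    refine ⟨i.1.1, i.1.2, i.2.1.1, haq i, ?_, (hbmem i x hi).2⟩
    have := (hbmem i x hi).1
    simp only [w, R] at this
    rwa [sub_mul, one_mul]
  · intro z r hr
    refine sum_smul_closedBall_le μ hPm hPdisj (fun i => ?_) (fun i hi t ht => ?_)
    · have := hprob i
      rw [ENNReal.ofReal_min, ENNReal.ofReal_one]
      refine le_min prob_le_one ?_
      exact cond_annulusBox_closedBall_le _ _ _ (by positivity) (hw_ge i) (by positivity) (hR_ge i)
        hr hα hα1 hβ hβn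
    · have hne : (b i ∩ Metric.closedBall z r).Nonempty := by
        by_contra hcon
        rw [not_nonempty_iff_eq_empty] at hcon
        rw [ProbabilityTheory.cond_apply (hbm i).measurableSet, hcon] at hi
        simp at hi
      obtain ⟨x, hxb, hxz⟩ := hne
      have h1 : dist x (y i) < R i := by rw [dist_eq_norm]; exact (hbmem i x hxb).2
      have h2 : dist t (y i) ≤ ρ i := Metric.mem_closedBall.1 (hPsub i ht)
      have h3 : dist x z ≤ r := hxz
      rw [Metric.mem_closedBall]
      have := dist_triangle_right t x (y i)
      have := dist_triangle t x z
      linarith [hRh i]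

/-- A measure carried by a compact subset of the unit cube, with bounded density, mass more than `m`
and a Frostman bound of exponent `s` with constant less than `C`. -/
structure IsFrostmanOn {n : ℕ} (s C m : ℝ) (μ : Measure (Fin n → ℝ)) (K : Set (Fin n → ℝ)) :
    Prop where
  isCompact : IsCompact K
  subset_unitCube : K ⊆ unitCube n
  measure_compl : μ Kᶜ = 0
  bounded_density : ∃ M : ℝ≥0, ∀ A, μ A ≤ M * volume A
  measure_closedBall_le : ∃ c, 0 ≤ c ∧ c < C ∧
    ∀ z r, 0 < r → μ (Metric.closedBall z r) ≤ ENNReal.ofReal (c * r ^ s)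
  lt_measure_univ : ENNReal.ofReal m < μ univ

lemma IsFrostmanOn.isFiniteMeasure {n : ℕ} {s C m : ℝ} {μ : Measure (Fin n → ℝ)}
    {K : Set (Fin n → ℝ)} (hμ : IsFrostmanOn s C m μ K) : IsFiniteMeasure μ := by
  obtain ⟨M, hM⟩ := hμ.bounded_density
  refine ⟨?_⟩
  rw [← union_compl_self K]
  refine (measure_union_le _ _).trans_lt ?_
  rw [hμ.measure_compl, add_zero]
  exact (hM K).trans_lt (ENNReal.mul_lt_top ENNReal.coe_lt_top hμ.isCompact.measure_lt_top)

lemma ball_bound_of_transport {n : ℕ} {μ ν : Measure (Fin n → ℝ)} {M : ℝ≥0}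
    (hM : ∀ A, μ A ≤ M * volume A) {s S c c' h ρ₀ D κ r : ℝ} {z : Fin n → ℝ} (hs : 0 < s)
    (hsS : s ≤ S) (hc0 : 0 ≤ c) (hr : 0 < r) (hh : 0 ≤ h) (hρ₀ : 0 < ρ₀) (hD : 0 ≤ D)
    (hκ0 : 0 ≤ κ)
    (hc : ∀ z r, 0 < r → μ (Metric.closedBall z r) ≤ ENNReal.ofReal (c * r ^ s))
    (hcc' : c * (1 + h / ρ₀) ^ s ≤ c') (hDc' : M * D * ρ₀ ^ (S - s) ≤ c')
    (hκ : r < ρ₀ → min 1 κ * (2 * (r + h)) ^ n ≤ D * r ^ S)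
    (hν : ν (Metric.closedBall z r) ≤
      ENNReal.ofReal (min 1 κ) * μ (Metric.closedBall z (r + h))) :
    ν (Metric.closedBall z r) ≤ ENNReal.ofReal (c' * r ^ s) := by
  refine hν.trans ?_
  rcases le_or_gt ρ₀ r with hρr | hρr
  · calc _ ≤ 1 * ENNReal.ofReal (c * (r + h) ^ s) := by
          gcongr
          · exact ENNReal.ofReal_le_one.2 (min_le_left _ _)
          · exact hc z _ (by linarith)
      _ ≤ _ := by
          rw [one_mul]
          refine ENNReal.ofReal_le_ofReal ?_
          calc c * (r + h) ^ s ≤ c * ((1 + h / ρ₀) * r) ^ s := by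
                gcongr
                have : h ≤ h / ρ₀ * r := by
                  rw [div_mul_eq_mul_div, le_div_iff₀ hρ₀]
                  exact mul_le_mul_of_nonneg_left hρr hh
                linarith
            _ = c * (1 + h / ρ₀) ^ s * r ^ s := by
                rw [Real.mul_rpow (by positivity) hr.le, mul_assoc]
            _ ≤ _ := by gcongr
  · have hκ1 : 0 ≤ min 1 κ := le_min zero_le_one hκ0
    calc _ ≤ ENNReal.ofReal (min 1 κ) * (ENNReal.ofReal M * ENNReal.ofReal ((2 * (r + h)) ^ n)) := by
          gcongr
          refine (hM _).trans ?_
          rw [Real.volume_pi_closedBall _ (by positivity), Fintype.card_fin,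
            ENNReal.ofReal_coe_nnreal]
      _ = ENNReal.ofReal (M * (min 1 κ * (2 * (r + h)) ^ n)) := by
          rw [← ENNReal.ofReal_mul (by positivity), ← ENNReal.ofReal_mul hκ1]
          congr 1; ring
      _ ≤ _ := by
          refine ENNReal.ofReal_le_ofReal ?_
          calc M * (min 1 κ * (2 * (r + h)) ^ n) ≤ M * (D * r ^ S) :=
                mul_le_mul_of_nonneg_left (hκ hρr) M.2
            _ = M * D * r ^ (S - s) * r ^ s := by
                rw [mul_assoc _ (r ^ (S - s)), ← Real.rpow_add hr, sub_add_cancel, mul_assoc]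
            _ ≤ M * D * ρ₀ ^ (S - s) * r ^ s := by
                gcongr
            _ ≤ _ := by gcongr

/-- The open set of points lying in one of the annuli of denominator at least `N`. -/
def annuliFrom (n : ℕ) (τ σ : ℝ) (N : ℕ) : Set (Fin n → ℝ) :=
  {x | ∃ (p : Fin n → ℤ) (q : ℕ), N ≤ q ∧ 0 < q ∧
    (1 - (q : ℝ) ^ (-σ)) * ((q : ℝ) ^ (-τ) / q) < ‖x - fun i => (p i : ℝ) / q‖ ∧
    ‖x - fun i => (p i : ℝ) / q‖ < (q : ℝ) ^ (-τ) / q}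

lemma isOpen_annuliFrom (n : ℕ) (τ σ : ℝ) (N : ℕ) : IsOpen (annuliFrom n τ σ N) := by
  simp only [annuliFrom, Set.ofPred_exists]
  refine isOpen_iUnion fun p => isOpen_iUnion fun q => ?_
  refine isOpen_const.and (isOpen_const.and (IsOpen.and ?_ ?_))
  · exact isOpen_lt (by fun_prop) (by fun_prop)
  · exact isOpen_lt (by fun_prop) (by fun_prop)

lemma mem_Wpsiphi_of_forall_mem_annuliFrom {n : ℕ} {τ σ : ℝ} {x : Fin n → ℝ}
    (hx : x ∈ unitCube n) (h : ∀ N, x ∈ annuliFrom n τ σ N) :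
    x ∈ Wpsiphi n (fun q => (q : ℝ) ^ (-τ)) (fun q => (q : ℝ) ^ (-σ)) := by
  refine ⟨hx, fun hfin => ?_⟩
  obtain ⟨B, hB⟩ := (hfin.image Prod.snd).bddAbove
  obtain ⟨p, q, hN, hq, hpq⟩ := h (B + 1)
  have : q ≤ B := hB ⟨(p, q), ⟨hq, hpq⟩, rfl⟩
  omega

lemma exists_isFrostmanOn_subset {n : ℕ} (hn : 0 < n) {τ σ α β s C m : ℝ}
    (hτ : (1 : ℝ) / n ≤ τ) (hσ : 0 < σ) (hα : 0 ≤ α) (hα1 : α ≤ 1) (hβ : 0 ≤ β)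
    (hβn : β ≤ n - 1) (hexp : (1 + τ + σ) * α + (1 + τ) * β ≤ n + 1) (hs : 0 < s)
    (hsαβ : s < α + β) (hm : 0 < m) {μ : Measure (Fin n → ℝ)} {K U : Set (Fin n → ℝ)}
    (hμ : IsFrostmanOn s C m μ K) (hU : IsOpen U) (hKU : K ⊆ U) (hUc : U ⊆ unitCube n) (N : ℕ) :
    ∃ (μ' : Measure (Fin n → ℝ)) (K' : Set (Fin n → ℝ)), IsFrostmanOn s C m μ' K' ∧
      K' ⊆ U ∩ annuliFrom n τ σ N := by
  have := hμ.isFiniteMeasure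
  obtain ⟨M, hM⟩ := hμ.bounded_density
  obtain ⟨c, hc0, hcC, hc⟩ := hμ.measure_closedBall_le
  obtain ⟨c', hcc', hc'C⟩ := exists_between hcC
  have hmass : m < (μ univ).toReal :=
    (ENNReal.ofReal_lt_iff_lt_toReal hm.le (measure_ne_top _ _)).1 hμ.lt_measure_univ
  set a : ℝ := ((μ univ).toReal - m) / (2 * (M * 8 ^ n + 1)) with ha_def
  have ha : 0 < a := div_pos (by linarith) (by positivity)
  have hMa : M * (8 ^ n * a) < (μ univ).toReal - m := by
    have h1 : a * (2 * (M * 8 ^ n + 1)) = (μ univ).toReal - m :=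
      div_mul_cancel₀ _ (by positivity)
    have h2 : 0 ≤ M * 8 ^ n * a := by positivity
    linarith
  obtain ⟨δ, hδ, hδU⟩ := hμ.isCompact.exists_thickening_subset_open hU hKU
  set A : ℝ := a⁻¹ + a ^ (-(1 + τ)) with hA
  have hA0 : 0 < A := by positivity
  set D : ℝ := 4 ^ α * 2 ^ β * (2 * (1 + A)) ^ n with hD
  have hD0 : 0 ≤ D := by positivity
  obtain ⟨ρ₀, hρ₀, hρ₀1, hDρ₀⟩ : ∃ ρ₀ : ℝ, 0 < ρ₀ ∧ ρ₀ ≤ 1 ∧ M * D * ρ₀ ^ (α + β - s) ≤ c' := by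
    have hlim : Tendsto (fun x : ℝ => M * D * x ^ (α + β - s)) (𝓝[>] 0) (𝓝 0) := by
      have : ContinuousAt (fun x : ℝ => M * D * x ^ (α + β - s)) 0 :=
        continuousAt_const.mul (Real.continuousAt_rpow_const _ _ (Or.inr (by linarith)))
      have h0 := this.tendsto
      rw [Real.zero_rpow (by linarith), mul_zero] at h0
      exact h0.mono_left nhdsWithin_le_nhds
    obtain ⟨x, hx, hx1⟩ := ((hlim.eventually_le_const (hc0.trans_lt hcc')).and
      (Ioc_mem_nhdsGT zero_lt_one)).exists
    exact ⟨x, hx1.1, hx1.2, hx⟩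
  have hpow : ∀ k : ℕ, k ≠ 0 → Tendsto (fun T : ℕ => (T : ℝ) ^ k) atTop atTop := fun k hk =>
    (tendsto_pow_atTop hk).comp tendsto_natCast_atTop_atTop
  have hh_lim : Tendsto (fun T : ℕ => A * ((T : ℝ) ^ (n + 1))⁻¹) atTop (𝓝 0) := by
    simpa using (tendsto_inv_atTop_zero.comp (hpow (n + 1) n.succ_ne_zero)).const_mul A
  have hc_lim : Tendsto (fun T : ℕ => c * (1 + A * ((T : ℝ) ^ (n + 1))⁻¹ / ρ₀) ^ s) atTop
      (𝓝 c) := by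
    have := (((hh_lim.div_const ρ₀).const_add 1).rpow_const (p := s) (Or.inr hs.le)).const_mul c
    simpa using this
  have haT_lim : Tendsto (fun T : ℕ => a * (T : ℝ) ^ n) atTop atTop :=
    (hpow n hn.ne').const_mul_atTop ha
  have hσ_lim := (tendsto_rpow_neg_atTop hσ).comp haT_lim
  obtain ⟨T, hTδ, hTc, hTN, hTσ, hT⟩ := ((hh_lim.eventually_lt_const hδ).and
    ((hc_lim.eventually_le_const hcc').and ((haT_lim.eventually_ge_atTop (N : ℝ)).and
    ((hσ_lim.eventually_le_const (by norm_num : (0 : ℝ) < 1 / 2)).and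
    (eventually_ge_atTop 2))))).exists
  obtain ⟨ν, K', hK', hνK', hνM, hνm, hnear, hann, hball⟩ := exists_transport hn hτ hσ hα hα1 hβ hβn
    ha hμ.subset_unitCube hμ.measure_compl hM hT hTσ rfl
  have hK'U : K' ⊆ U := fun x hx => by
    obtain ⟨y, hy, hxy⟩ := hnear x hx
    exact hδU (Metric.mem_thickening_iff.2 ⟨y, hy, hxy.trans_lt hTδ⟩)
  refine ⟨ν, K', ⟨hK', hK'U.trans hUc, hνK', hνM, ⟨c', (hc0.trans_lt hcc').le, hc'C,
    fun z r hr => ?_⟩, ?_⟩, fun x hx => ⟨hK'U hx, ?_⟩⟩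
  · have hT1 : (1 : ℝ) ≤ T := by exact_mod_cast (by omega : 1 ≤ T)
    refine ball_bound_of_transport hM hs hsαβ.le hc0 hr (by positivity) hρ₀ hD0 (by positivity) hc
      hTc hDρ₀ (fun hrρ => ?_) (hball z r hr)
    exact min_mul_pow_le hα hβ (by linarith) hexp hA0.le hT1 hr (hrρ.le.trans hρ₀1)
  · by_contra! hcon
    refine absurd hνm (not_le.2 ?_)
    calc _ ≤ ENNReal.ofReal m + ENNReal.ofReal M * ENNReal.ofReal (8 ^ n * a) := by
          rw [ENNReal.ofReal_coe_nnreal]; gcongr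
      _ = ENNReal.ofReal (m + M * (8 ^ n * a)) := by
          rw [← ENNReal.ofReal_mul (by positivity), ← ENNReal.ofReal_add hm.le (by positivity)]
      _ < μ univ := by
          rw [ENNReal.ofReal_lt_iff_lt_toReal (by positivity) (measure_ne_top _ _)]
          linarith
  · obtain ⟨p, q, hq, haq, hx⟩ := hann x hx
    exact ⟨p, q, by exact_mod_cast hTN.trans haq.le, hq, hx⟩

lemma exists_isFrostmanOn (n : ℕ) {s : ℝ} (hs : 0 < s) (hsn : s ≤ n) :
    ∃ (μ : Measure (Fin n → ℝ)) (K : Set (Fin n → ℝ)),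
      IsFrostmanOn s (2 ^ n + 1) ((1 / 2) ^ n / 2) μ K ∧ K ⊆ interior (unitCube n) := by
  set K : Set (Fin n → ℝ) := Metric.closedBall (fun _ => 1 / 2) (1 / 4) with hK
  have hvol : volume K = ENNReal.ofReal ((1 / 2) ^ n) := by
    rw [hK, Real.volume_pi_closedBall _ (by norm_num), Fintype.card_fin]
    norm_num
  have hKint : K ⊆ interior (unitCube n) := by
    refine subset_trans (fun x hx => ?_) (interior_maximal (?_ :
      Metric.ball (fun _ => 1 / 2) (1 / 2) ⊆ unitCube n) Metric.isOpen_ball)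
    · exact Metric.closedBall_subset_ball (by norm_num) hx
    · intro x hx i _
      have h1 := (dist_le_pi_dist x (fun _ => 1 / 2) i).trans (Metric.mem_ball.1 hx).le
      rw [Real.dist_eq, abs_le] at h1
      constructor <;> linarith [h1.1, h1.2]
  refine ⟨volume.restrict K, K, ⟨isCompact_closedBall _ _, hKint.trans interior_subset, ?_,
    ⟨1, fun A => ?_⟩, ⟨2 ^ n, by positivity, by linarith, fun z r hr => ?_⟩, ?_⟩, hKint⟩
  · rw [Measure.restrict_apply Metric.isClosed_closedBall.measurableSet.compl, compl_inter_self,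
      measure_empty]
  · simpa using Measure.restrict_apply_le K A
  · rcases le_total r 1 with h | h
    · refine (Measure.restrict_apply_le K _).trans ?_
      rw [Real.volume_pi_closedBall _ hr.le, Fintype.card_fin, mul_pow]
      refine ENNReal.ofReal_le_ofReal (mul_le_mul_of_nonneg_left ?_ (by positivity))
      rw [← Real.rpow_natCast]
      exact Real.rpow_le_rpow_of_exponent_ge hr h hsn
    · refine (measure_mono (subset_univ _)).trans ?_
      rw [Measure.restrict_apply_univ, hvol]
      refine ENNReal.ofReal_le_ofReal ?_
      calc ((1 : ℝ) / 2) ^ n ≤ 1 := pow_le_one₀ (by norm_num) (by norm_num)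
        _ ≤ 2 ^ n * r ^ s := one_le_mul_of_one_le_of_one_le (one_le_pow₀ (by norm_num))
          (Real.one_le_rpow h hs.le)
  · rw [Measure.restrict_apply_univ, hvol]
    have : (0 : ℝ) < (1 / 2) ^ n := by positivity
    exact (ENNReal.ofReal_lt_ofReal_iff this).2 (by linarith)

lemma ofReal_le_dimH_Wpsiphi {n : ℕ} (hn : 0 < n) {τ σ α β s : ℝ} (hτ : (1 : ℝ) / n ≤ τ)
    (hσ : 0 < σ) (hα : 0 ≤ α) (hα1 : α ≤ 1) (hβ : 0 ≤ β) (hβn : β ≤ n - 1)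
    (hexp : (1 + τ + σ) * α + (1 + τ) * β ≤ n + 1) (hs : 0 < s) (hsαβ : s < α + β) :
    ENNReal.ofReal s ≤ dimH (Wpsiphi n (fun q => (q : ℝ) ^ (-τ)) (fun q => (q : ℝ) ^ (-σ))) := by
  refine le_dimH_of_step (V₀ := unitCube n) hs (C := 2 ^ n + 1) (m := (1 / 2) ^ n / 2)
    (by positivity) (by positivity) (IsFrostmanOn s (2 ^ n + 1) ((1 / 2) ^ n / 2))
    (annuliFrom n τ σ) (isOpen_annuliFrom n τ σ) (isCompact_univ_pi fun _ => isCompact_Icc)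
    (fun x hx h => mem_Wpsiphi_of_forall_mem_annuliFrom hx h) (fun μ K h => h.isCompact)
    (fun μ K h => h.measure_compl) (fun μ K h => h.lt_measure_univ) (fun μ K h z r hr => ?_)
    (exists_isFrostmanOn n hs (by linarith)) (fun μ K U N h hU hKU hUc => ?_)
  · obtain ⟨c, -, hcC, hc⟩ := h.measure_closedBall_le
    exact (hc z r hr).trans (ENNReal.ofReal_le_ofReal (by gcongr))
  · exact exists_isFrostmanOn_subset hn hτ hσ hα hα1 hβ hβn hexp hs hsαβ (by positivity) h hU hKU
      hUc N

theorem le_dimH_Wpsiphi {n : ℕ} (hn : 0 < n) {τ σ : ℝ} (hσ : 0 < σ) (hτ : (1 : ℝ) / n ≤ τ) :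
    ENNReal.ofReal (min (((n : ℝ) + 1) / (1 + τ))
      (((n : ℝ) + 1 + ((n : ℝ) - 1) * σ) / (1 + τ + σ))) ≤
      dimH (Wpsiphi n (fun q => (q : ℝ) ^ (-τ)) (fun q => (q : ℝ) ^ (-σ))) := by
  have hn' : (1 : ℝ) ≤ n := by exact_mod_cast hn
  have hτ0 : 0 < τ := lt_of_lt_of_le (by positivity) hτ
  have hτn : 1 ≤ n * τ := by
    rw [div_le_iff₀ (by linarith)] at hτ; linarith
  set S := min (((n : ℝ) + 1) / (1 + τ)) (((n : ℝ) + 1 + ((n : ℝ) - 1) * σ) / (1 + τ + σ)) with hS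
  have hS1 : S * (1 + τ) ≤ n + 1 := (le_div_iff₀ (by linarith)).1 (min_le_left _ _)
  have hS2 : S * (1 + τ + σ) ≤ n + 1 + (n - 1) * σ :=
    (le_div_iff₀ (by linarith)).1 (min_le_right _ _)
  have hSn : S ≤ n := by
    refine (min_le_left _ _).trans ((div_le_iff₀ (by linarith)).2 (by linarith))
  refine le_of_forall_lt fun d hd => ?_
  have hd' : d.toReal < S := (ENNReal.lt_ofReal_iff_toReal_lt hd.ne_top).1 hd
  obtain ⟨s, hds, hsS⟩ := exists_between hd'
  have hs : 0 < s := ENNReal.toReal_nonneg.trans_lt hds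
  refine ((ENNReal.lt_ofReal_iff_toReal_lt hd.ne_top).2 hds).trans_le
    (ofReal_le_dimH_Wpsiphi hn (α := max 0 (S - (n - 1))) (β := S - max 0 (S - (n - 1))) hτ hσ
      (le_max_left _ _) (max_le zero_le_one (by linarith)) ?_ ?_ ?_ hs (by linarith))
  · exact sub_nonneg.2 (max_le (hs.trans hsS).le (by linarith))
  · linarith [le_max_right 0 (S - (n - 1))]
  · rcases le_total 0 (S - (n - 1)) with h | h
    · rw [max_eq_right h]; linarith
    · rw [max_eq_left h]; linarith

theorem stmt0 (n : ℕ) (hn : 0 < n) (τψ τφ : ℝ) (hτψ : 0 < τψ) (hτφ : 0 < τφ)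
    (h : (1 : ℝ) / n ≤ τψ) :
    dimH (Wpsiphi n (fun q => (q : ℝ) ^ (-τψ)) (fun q => (q : ℝ) ^ (-τφ))) =
      ENNReal.ofReal
        (min (((n : ℝ) + 1) / (1 + τψ))
          (((n : ℝ) + 1 + ((n : ℝ) - 1) * τφ) / (1 + τψ + τφ))) := by
  exact le_antisymm (dimH_Wpsiphi_le hn hτψ hτφ.le) (le_dimH_Wpsiphi hn hτφ h)
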